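/- arXiv:cs/0512060 — 3 statements merged into one kernel-verified Lean document; each statement's English description precedes it below -/
import Mathlib

section
/- Let s > 0 and let Q = [0,s] × [0,s] be a closed axis-aligned square in the Euclidean plane ℝ². For any two points a and b on the boundary (frontier) of Q, there exists a continuous path f : [0,1] → ℝ² with f(0) = a, f(1) = b, whose image is contained in the boundary of Q, and whose total length (total variation of f over [0,1]) is at most 2 · dist(a, b), where dist is the Euclidean distance. (This is the single-square core of the paper's theorem that the shortest path along the streets of the adaptive skeleton graph is at most twice the optimal path: a path segment crossing a danger-free square can be replaced by a boundary path at most twice as long.) -/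
open Set

/-- `a` and `b` are joined inside `S` by a path of length at most `L`. -/
def JoinedWithLength {E : Type*} [PseudoEMetricSpace E] (S : Set E) (a b : E) (L : ENNReal) :
    Prop :=
  ∃ f : ℝ → E, ContinuousOn f (Icc 0 1) ∧ f 0 = a ∧ f 1 = b ∧ f '' Icc 0 1 ⊆ S ∧
    eVariationOn f (Icc 0 1) ≤ L

theorem JoinedWithLength.mono {E : Type*} [PseudoEMetricSpace E] {S : Set E} {a b : E}
    {L L' : ENNReal} (h : JoinedWithLength S a b L) (hL : L ≤ L') : JoinedWithLength S a b L' := by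
  obtain ⟨f, h1, h2, h3, h4, h5⟩ := h
  exact ⟨f, h1, h2, h3, h4, h5.trans hL⟩

theorem JoinedWithLength.trans {E : Type*} [PseudoEMetricSpace E] {S : Set E} {a b c : E}
    {L L' : ENNReal} (hab : JoinedWithLength S a b L) (hbc : JoinedWithLength S b c L') :
    JoinedWithLength S a c (L + L') := by
  obtain ⟨f, hf, f0, f1, fS, fL⟩ := hab
  obtain ⟨g, hg, g0, g1, gS, gL⟩ := hbc
  set F : ℝ → E := fun t => if t ≤ 1 / 2 then f (2 * t) else g (2 * t - 1) with hF
  have hl : EqOn F (f ∘ fun t => 2 * t) (Icc 0 (1 / 2)) := fun t ht => by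
    simp only [hF, Function.comp, if_pos ht.2]
  have hr : EqOn F (g ∘ fun t => 2 * t - 1) (Icc (1 / 2) 1) := fun t ht => by
    rcases ht.1.eq_or_lt with rfl | h
    · norm_num [hF, f1, g0]
    · simp only [hF, Function.comp, if_neg h.not_ge]
  have ml : MapsTo (fun t : ℝ => 2 * t) (Icc 0 (1 / 2)) (Icc 0 1) := fun t ht =>
    ⟨by linarith [ht.1], by linarith [ht.2]⟩
  have mr : MapsTo (fun t : ℝ => 2 * t - 1) (Icc (1 / 2) 1) (Icc 0 1) := fun t ht =>
    ⟨by linarith [ht.1], by linarith [ht.2]⟩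
  have hu : Icc (0 : ℝ) (1 / 2) ∪ Icc (1 / 2) 1 = Icc 0 1 :=
    Icc_union_Icc_eq_Icc (by norm_num) (by norm_num)
  refine ⟨F, ?_, by norm_num [hF, f0], by norm_num [hF, g1], ?_, ?_⟩
  · rw [← hu]
    exact ((hf.comp (by fun_prop) ml).congr hl).union_of_isClosed
      ((hg.comp (by fun_prop) mr).congr hr) isClosed_Icc isClosed_Icc
  · rw [← hu, image_union, hl.image_eq, hr.image_eq, image_comp, image_comp]
    exact union_subset ((image_mono ml.image_subset).trans fS)
      ((image_mono mr.image_subset).trans gS)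
  · rw [← hu, eVariationOn.union F (isGreatest_Icc (by norm_num)) (isLeast_Icc (by norm_num)),
      eVariationOn.congr hl, eVariationOn.congr hr]
    exact add_le_add
      ((eVariationOn.comp_le_of_monotoneOn f _ (fun _ _ _ _ h => by linarith) ml).trans fL)
      ((eVariationOn.comp_le_of_monotoneOn g _ (fun _ _ _ _ h => by linarith) mr).trans gL)

theorem joinedWithLength_of_segment_subset {E : Type*} [NormedAddCommGroup E] [NormedSpace ℝ E]
    {S : Set E} {a b : E} (h : segment ℝ a b ⊆ S) : JoinedWithLength S a b (edist a b) := by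
  refine ⟨AffineMap.lineMap a b, AffineMap.lineMap_continuous.continuousOn, by simp, by simp, ?_, ?_⟩
  · rwa [← segment_eq_image_lineMap]
  · have h1 := (lipschitzWith_lineMap (𝕜 := ℝ) a b).lipschitzOnWith (s := univ)
      |>.comp_eVariationOn_le (g := id) (s := Icc (0 : ℝ) 1) (mapsTo_univ _ _)
    have h2 := (monotoneOn_id (s := Icc (0 : ℝ) 1)).eVariationOn_eq (left_mem_Icc.2 zero_le_one)
      (right_mem_Icc.2 zero_le_one)
    simp only [inter_self, id, sub_zero, ENNReal.ofReal_one] at h2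
    refine h1.trans ((mul_le_mul_right h2.le _).trans ?_)
    rw [mul_one, edist_nndist]

theorem EuclideanSpace.isOpenMap_apply {ι : Type*} [Fintype ι] (i : ι) :
    IsOpenMap fun p : EuclideanSpace ℝ ι => p i := by
  classical
  exact (EuclideanSpace.proj (𝕜 := ℝ) i).isOpenMap
    fun x => ⟨EuclideanSpace.single i x, by simp⟩

theorem mem_frontier_square_iff {s : ℝ} {p : EuclideanSpace ℝ (Fin 2)} :
    p ∈ frontier {p : EuclideanSpace ℝ (Fin 2) | p 0 ∈ Icc 0 s ∧ p 1 ∈ Icc 0 s} ↔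
      (∀ i, p i ∈ Icc 0 s) ∧ ∃ i, p i = 0 ∨ p i = s := by
  have hc (i : Fin 2) : Continuous fun p : EuclideanSpace ℝ (Fin 2) => p i := by fun_prop
  have hcl : IsClosed {p : EuclideanSpace ℝ (Fin 2) | p 0 ∈ Icc 0 s ∧ p 1 ∈ Icc 0 s} :=
    (isClosed_Icc.preimage (hc 0)).inter (isClosed_Icc.preimage (hc 1))
  have hi : interior {p : EuclideanSpace ℝ (Fin 2) | p 0 ∈ Icc 0 s ∧ p 1 ∈ Icc 0 s} =
      {p | p 0 ∈ Ioo 0 s ∧ p 1 ∈ Ioo 0 s} := by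
    rw [ofPred_and, interior_inter, ofPred_and]
    congr 1 <;> rw [← interior_Icc] <;>
      exact ((EuclideanSpace.isOpenMap_apply _).preimage_interior_eq_interior_preimage
        (hc _) _).symm
  rw [hcl.frontier_eq, hi]
  simp only [mem_sdiff, mem_ofPred_eq, mem_Icc, mem_Ioo, Fin.forall_fin_two, Fin.exists_fin_two]
  clear hc hcl hi
  grind

theorem EuclideanSpace.dist_eq_abs_of_apply_eq {a b : EuclideanSpace ℝ (Fin 2)} {i j : Fin 2}
    (hij : i ≠ j) (h : a i = b i) : dist a b = |a j - b j| := by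
  rw [EuclideanSpace.dist_eq, ← Real.sqrt_sq_eq_abs]
  fin_cases i <;> fin_cases j <;> simp_all [Real.dist_eq]

theorem EuclideanSpace.abs_sub_apply_le_dist {ι : Type*} [Fintype ι] (a b : EuclideanSpace ℝ ι)
    (i : ι) : |a i - b i| ≤ dist a b := by
  rw [dist_eq_norm, ← Real.norm_eq_abs]
  exact PiLp.norm_apply_le (a - b) i

theorem joinedWithLength_frontier_square_of_apply_eq {s : ℝ} {a b : EuclideanSpace ℝ (Fin 2)}
    (ha : ∀ k, a k ∈ Icc 0 s) (hb : ∀ k, b k ∈ Icc 0 s) {i j : Fin 2} (hij : i ≠ j)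
    (hi : a i = 0 ∨ a i = s) (hab : a i = b i) :
    JoinedWithLength
      (frontier {p : EuclideanSpace ℝ (Fin 2) | p 0 ∈ Icc 0 s ∧ p 1 ∈ Icc 0 s}) a b
      (ENNReal.ofReal |a j - b j|) := by
  rw [← EuclideanSpace.dist_eq_abs_of_apply_eq hij hab, ← edist_dist]
  refine joinedWithLength_of_segment_subset ?_
  rintro _ ⟨x, y, hx, hy, hxy, rfl⟩
  refine mem_frontier_square_iff.2 ⟨fun k => ?_, i, ?_⟩
  · exact convex_Icc 0 s (ha k) (hb k) hx hy hxy
  · have : (x • a + y • b) i = a i := by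
      simp only [PiLp.add_apply, PiLp.smul_apply, smul_eq_mul, ← hab, ← add_mul, hxy, one_mul]
    rwa [this]


/-- The single-square core of the adaptive-skeleton-graph theorem: for any two
points `a`, `b` on the boundary of the square `[0,s] × [0,s]`, there is a
continuous path along the boundary from `a` to `b` of total length at most
`2 · dist a b`. -/
theorem boundary_path_of_square (s : ℝ) (hs : 0 < s)
    (a b : EuclideanSpace ℝ (Fin 2))
    (ha : a ∈ frontier {p : EuclideanSpace ℝ (Fin 2) |
      p 0 ∈ Set.Icc 0 s ∧ p 1 ∈ Set.Icc 0 s})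
    (hb : b ∈ frontier {p : EuclideanSpace ℝ (Fin 2) |
      p 0 ∈ Set.Icc 0 s ∧ p 1 ∈ Set.Icc 0 s}) :
    ∃ f : ℝ → EuclideanSpace ℝ (Fin 2),
      ContinuousOn f (Set.Icc 0 1) ∧
      f 0 = a ∧ f 1 = b ∧
      f '' Set.Icc 0 1 ⊆ frontier {p : EuclideanSpace ℝ (Fin 2) |
        p 0 ∈ Set.Icc 0 s ∧ p 1 ∈ Set.Icc 0 s} ∧
      eVariationOn f (Set.Icc 0 1) ≤ ENNReal.ofReal (2 * dist a b) := by
  change JoinedWithLength _ a b _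
  obtain ⟨ha, i, hi⟩ := mem_frontier_square_iff.1 ha
  obtain ⟨hb, j, hj⟩ := mem_frontier_square_iff.1 hb
  have h0 : (0 : ℝ) ∈ Icc 0 s := ⟨le_rfl, hs.le⟩
  have h1 : s ∈ Icc 0 s := ⟨hs.le, le_rfl⟩
  have hvert {v : ℝ} (hv : v = 0 ∨ v = s) : v ∈ Icc 0 s := by
    rcases hv with rfl | rfl <;> assumption
  by_cases hij : i = j
  · subst hij
    obtain ⟨k, hk⟩ : ∃ k : Fin 2, i ≠ k := ⟨i + 1, by fin_cases i <;> decide⟩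
    have hdi := EuclideanSpace.abs_sub_apply_le_dist a b i
    have hdk := EuclideanSpace.abs_sub_apply_le_dist a b k
    by_cases hab : a i = b i
    · exact (joinedWithLength_frontier_square_of_apply_eq ha hb hk hi hab).mono
        (ENNReal.ofReal_le_ofReal (by linarith [abs_nonneg (a k - b k)]))
    · obtain ⟨u, hu, hus⟩ : ∃ u, (u = 0 ∨ u = s) ∧ |a k - u| + |u - b k| ≤ s := by
        have hak := ha k
        have hbk := hb k
        rcases le_total (a k + b k) s with h | h
        · exact ⟨0, .inl rfl, by
            rw [sub_zero, zero_sub, abs_neg, abs_of_nonneg hak.1, abs_of_nonneg hbk.1]; exact h⟩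
        · exact ⟨s, .inr rfl, by
            rw [abs_sub_comm, abs_of_nonneg (sub_nonneg.2 hak.2),
              abs_of_nonneg (sub_nonneg.2 hbk.2)]; linarith⟩
      have hsd : |a i - b i| = s := by
        rcases hi with h | h <;> rcases hj with h' | h' <;> simp_all [abs_of_pos]
      let corner (v : ℝ) : EuclideanSpace ℝ (Fin 2) := WithLp.toLp 2 fun l => if l = i then v else u
      have ci (v : ℝ) : corner v i = v := by simp [corner]
      have ck (v : ℝ) : corner v k = u := by simp [corner, hk.symm]
      have hc {v : ℝ} (hv : v = 0 ∨ v = s) (l : Fin 2) : corner v l ∈ Icc 0 s := by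
        dsimp only [corner]
        split_ifs
        exacts [hvert hv, hvert hu]
      have p1 := joinedWithLength_frontier_square_of_apply_eq ha (hc hi) hk hi (ci _).symm
      have p2 := joinedWithLength_frontier_square_of_apply_eq (hc hi) (hc hj) hk.symm
        (by rwa [ck]) (by rw [ck, ck])
      have p3 := joinedWithLength_frontier_square_of_apply_eq (hc hj) hb hk (by rwa [ci]) (ci _)
      refine ((p1.trans p2).trans p3).mono ?_
      rw [← ENNReal.ofReal_add (abs_nonneg _) (abs_nonneg _),
        ← ENNReal.ofReal_add (by positivity) (abs_nonneg _), ck, ck, ci, ci]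
      exact ENNReal.ofReal_le_ofReal (by linarith)
  · let c : EuclideanSpace ℝ (Fin 2) := WithLp.toLp 2 fun l => if l = i then a i else b j
    have ci : c i = a i := by simp [c]
    have cj : c j = b j := by simp [c, Ne.symm hij]
    have hc (l : Fin 2) : c l ∈ Icc 0 s := by
      dsimp only [c]
      split_ifs
      exacts [ha i, hb j]
    have p1 := joinedWithLength_frontier_square_of_apply_eq ha hc hij hi ci.symm
    have p2 := joinedWithLength_frontier_square_of_apply_eq hc hb (Ne.symm hij) (by rwa [cj]) cj
    refine (p1.trans p2).mono ?_
    rw [← ENNReal.ofReal_add (abs_nonneg _) (abs_nonneg _), ci, cj]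
    exact ENNReal.ofReal_le_ofReal (by
      linarith [EuclideanSpace.abs_sub_apply_le_dist a b i,
        EuclideanSpace.abs_sub_apply_le_dist a b j])
end

section
/- Let β > 1, D > 0, c_a > 0, let z ∈ ℝ² be a danger point, and let γ : ℝ → ℝ² be continuously differentiable on [0,1] with dist(γ(t), z) ≥ D for all t ∈ [0,1]. Suppose that for every integer k ≥ 1, the length of the portion of the path lying in the annulus at distances [kD, (k+1)D) from z is at most c_a · D; that is, ∫_{{t ∈ [0,1] : kD ≤ dist(γ(t),z) < (k+1)D}} ‖γ′(t)‖ dt ≤ c_a · D. Then the exposure of γ satisfies ∫₀¹ ‖γ′(t)‖ / dist(γ(t), z)^β dt ≤ (c_a / D^{β−1}) · ∑_{k=1}^{∞} 1/k^β, and in particular this bound is finite. (This is the case L ≥ D of the paper's exposure lemma: dividing a well-behaved curve by concentric circles of radii D, 2D, 3D, …, each annular segment has length at most c_a·D and potential at most 1/(kD)^β, so the total exposure is at most a constant times 1/D^{β−1}.) -/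
open Set MeasureTheory

/-- The speed of a path that is `C¹` on a compact interval is integrable there. -/
lemma integrableOn_norm_deriv_Icc {E : Type*} [NormedAddCommGroup E] [NormedSpace ℝ E]
    {f : ℝ → E} {a b : ℝ} (hab : a < b) (hf : ContDiffOn ℝ 1 f (Icc a b)) :
    IntegrableOn (fun t => ‖deriv f t‖) (Icc a b) := by
  rw [integrableOn_Icc_iff_integrableOn_Ioo]
  have hcont : ContinuousOn (fun t => ‖derivWithin f (Icc a b) t‖) (Icc a b) :=
    (hf.continuousOn_derivWithin (uniqueDiffOn_Icc hab) le_rfl).norm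
  refine (hcont.integrableOn_Icc.mono_set Ioo_subset_Icc_self).congr_fun (fun t ht => ?_)
    measurableSet_Ioo
  simp only [derivWithin_of_mem_nhds (Icc_mem_nhds ht.1 ht.2)]

/-- Exposure lemma, case `L ≥ D`: if the length of the portion of the path in
each annulus `kD ≤ dist < (k+1)D` (for `k ≥ 1`) is at most `c_a · D`, then the
exposure of the path is at most `(c_a / D^(β-1)) · ∑_{k≥1} 1/k^β`, the series
being summable since `β > 1`. -/
theorem exposure_le_of_annulus_lengths (β D ca : ℝ) (hβ : 1 < β) (hD : 0 < D)
    (hca : 0 < ca)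
    (z : EuclideanSpace ℝ (Fin 2)) (γ : ℝ → EuclideanSpace ℝ (Fin 2))
    (hγ : ContDiffOn ℝ 1 γ (Icc 0 1))
    (hdist : ∀ t ∈ Icc (0:ℝ) 1, D ≤ dist (γ t) z)
    (hann : ∀ k : ℕ, 1 ≤ k →
      (∫ t in {t ∈ Icc (0:ℝ) 1 |
          (k : ℝ) * D ≤ dist (γ t) z ∧ dist (γ t) z < ((k : ℝ) + 1) * D},
        ‖deriv γ t‖) ≤ ca * D) :
    Summable (fun k : ℕ+ => 1 / (k : ℝ) ^ β) ∧
    ∫ t in (0:ℝ)..1, ‖deriv γ t‖ / dist (γ t) z ^ β ≤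
      (ca / D ^ (β - 1)) * ∑' k : ℕ+, 1 / (k : ℝ) ^ β := by
  have hsum : Summable (fun k : ℕ+ => 1 / (k : ℝ) ^ β) :=
    (Real.summable_one_div_nat_rpow.2 hβ).comp_injective PNat.coe_injective
  refine ⟨hsum, ?_⟩
  have hr : ContinuousOn (fun t => dist (γ t) z) (Icc 0 1) :=
    continuous_dist.comp_continuousOn (hγ.continuousOn.prodMk continuousOn_const)
  have hspeed := integrableOn_norm_deriv_Icc zero_lt_one hγ
  have hrpos : ∀ t ∈ Icc (0:ℝ) 1, 0 < dist (γ t) z := fun t ht => hD.trans_le (hdist t ht)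
  have hint : IntegrableOn (fun t => ‖deriv γ t‖ / dist (γ t) z ^ β) (Icc 0 1) := by
    simp only [div_eq_mul_inv]
    refine hspeed.mul_continuousOn ?_ isCompact_Icc
    exact (hr.rpow_const fun t ht => Or.inl (hrpos t ht).ne').inv₀
      fun t ht => (Real.rpow_pos_of_pos (hrpos t ht) β).ne'
  let A : ℕ+ → Set ℝ := fun k => {t ∈ Icc (0:ℝ) 1 |
    (k : ℝ) * D ≤ dist (γ t) z ∧ dist (γ t) z < ((k : ℝ) + 1) * D}
  have hA_subset : ∀ k, A k ⊆ Icc 0 1 := fun k t ht => ht.1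
  have hA_meas : ∀ k, MeasurableSet (A k) := by
    intro k
    have hclosed : ∀ c : ℝ, MeasurableSet (Icc 0 1 ∩ (fun t => dist (γ t) z) ⁻¹' Ici c) :=
      fun c => (hr.preimage_isClosed_of_isClosed isClosed_Icc isClosed_Ici).measurableSet
    convert (hclosed ((k : ℝ) * D)).diff (hclosed (((k : ℝ) + 1) * D)) using 1
    ext t
    simp only [A, mem_ofPred_eq, mem_sdiff, mem_inter_iff, mem_preimage, mem_Ici, ← not_le]
    tauto
  have hA_floor : ∀ k, ∀ t ∈ A k, ⌊dist (γ t) z / D⌋₊ = k := fun k t ht =>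
    (Nat.floor_eq_iff (by positivity)).2
      ⟨(le_div_iff₀ hD).2 ht.2.1, (div_lt_iff₀ hD).2 ht.2.2⟩
  have hA_disj : Pairwise (Function.onFun Disjoint A) := fun k l hkl =>
    disjoint_left.2 fun t hk hl =>
      hkl (PNat.coe_injective ((hA_floor k t hk).symm.trans (hA_floor l t hl)))
  have hA_union : ⋃ k, A k = Icc 0 1 := by
    refine (iUnion_subset hA_subset).antisymm fun t ht => mem_iUnion.2 ?_
    have hone : 1 ≤ dist (γ t) z / D := (one_le_div hD).2 (hdist t ht)
    refine ⟨⟨⌊dist (γ t) z / D⌋₊, Nat.floor_pos.2 hone⟩, ht, ?_, ?_⟩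
    · exact (le_div_iff₀ hD).1 (Nat.floor_le (by positivity))
    · exact (div_lt_iff₀ hD).1 (Nat.lt_floor_add_one _)
  have hdecomp := hasSum_integral_iUnion hA_meas hA_disj (hA_union.symm ▸ hint)
  rw [hA_union] at hdecomp
  rw [intervalIntegral.integral_of_le zero_le_one, ← integral_Icc_eq_integral_Ioc]
  refine hasSum_le (fun k => ?_) hdecomp (hsum.hasSum.mul_left (ca / D ^ (β - 1)))
  have hk : (0:ℝ) < k := by exact_mod_cast k.pos
  calc ∫ t in A k, ‖deriv γ t‖ / dist (γ t) z ^ β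
      ≤ ∫ t in A k, ‖deriv γ t‖ / ((k : ℝ) * D) ^ β := by
        refine setIntegral_mono_on (hint.mono_set (hA_subset k))
          ((hspeed.mono_set (hA_subset k)).div_const _) (hA_meas k) fun t ht => ?_
        have := ht.2.1
        gcongr
    _ = (∫ t in A k, ‖deriv γ t‖) / ((k : ℝ) * D) ^ β := integral_div _ _
    _ ≤ ca * D / ((k : ℝ) * D) ^ β := by
        gcongr
        exact hann k k.pos
    _ = ca / D ^ (β - 1) * (1 / (k : ℝ) ^ β) := by
        rw [Real.mul_rpow hk.le hD.le, Real.rpow_sub_one hD.ne']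
        field_simp
end

section
/- Let N > 0 and 0 < s ≤ N be real numbers, let m = ⌊N/s⌋, and in the Euclidean plane consider the grid street map G consisting of the portions inside the square [0,N] × [0,N] of the vertical lines x = j·s for integers 0 ≤ j ≤ m together with the horizontal lines y = j·s for integers 0 ≤ j ≤ m. Let Z ⊆ [0,N] × [0,N] be a danger zone whose boundary ∂Z satisfies the well-behavedness condition that the one-dimensional Hausdorff measure of ∂Z inside any axis-aligned square box of side x is at most c·x, for a constant c > 1. Then the one-dimensional Hausdorff measure of the full street map G ∪ ∂Z is at most 2·(m+1)·N + c·N. In particular, taking n = N² and s = n^{1/2−ε} with 0 < ε < 1/2, the total street length is O(n^{1/2+ε}). (This is the content of the paper's theorem that the communication cost of discovering the shortest path in the uniform skeleton graph is O(n^{1/2+ε}): the total length of the grid streets is O(n/s) and of the perimeter streets is O(n^{1/2}).) -/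
open MeasureTheory Set

/-- A segment `{v + t • eᵢ | t ∈ [a, b]}` parallel to a coordinate axis has length `b - a`. -/
theorem hausdorffMeasure_image_add_single_Icc (v : EuclideanSpace ℝ (Fin 2)) (i : Fin 2) (a b : ℝ) :
    μH[1] ((fun t : ℝ => v + EuclideanSpace.single i t) '' Icc a b) = ENNReal.ofReal (b - a) := by
  have hiso : Isometry (fun t : ℝ => v + EuclideanSpace.single i t) :=
    Isometry.of_dist_eq fun x y => by
      rw [dist_add_left, PiLp.dist_single_same]
  rw [hiso.hausdorffMeasure_image (Or.inl zero_le_one), hausdorffMeasure_real, Real.volume_Icc]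

/-- The union of the lines on which the coordinate `i` equals `r j`, for `j ≤ m`, cut off to
`[0, N]` in the other coordinate `k`, has length at most `(m + 1) * N`. -/
theorem hausdorffMeasure_parallel_segments_le (N : ℝ) (r : ℕ → ℝ) (m : ℕ)
    {i k : Fin 2} (hik : i ≠ k) :
    μH[1] {p : EuclideanSpace ℝ (Fin 2) | ∃ j : ℕ, j ≤ m ∧ p i = r j ∧ p k ∈ Icc 0 N} ≤
      ENNReal.ofReal ((m + 1) * N) := by
  have hsub : {p : EuclideanSpace ℝ (Fin 2) | ∃ j : ℕ, j ≤ m ∧ p i = r j ∧ p k ∈ Icc 0 N} ⊆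
      ⋃ j ∈ Finset.range (m + 1), (fun t : ℝ =>
        EuclideanSpace.single i (r j) + EuclideanSpace.single k t) '' Icc 0 N := by
    rintro p ⟨j, hj, hpi, hpk⟩
    refine mem_biUnion (Finset.mem_coe.2 (Finset.mem_range.2 (Nat.lt_succ_of_le hj)))
      ⟨p k, hpk, ?_⟩
    ext l
    have hl : l = i ∨ l = k := by omega
    rcases hl with rfl | rfl
    · simp [hpi, hik]
    · simp [hik.symm]
  calc _ ≤ _ := measure_mono hsub
    _ ≤ _ := measure_biUnion_finset_le _ _
    _ = ENNReal.ofReal ((m + 1) * N) := by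
      simp only [hausdorffMeasure_image_add_single_Icc, sub_zero, Finset.sum_const, Finset.card_range,
        nsmul_eq_mul]
      rw [ENNReal.ofReal_mul (by positivity), ← Nat.cast_succ, ENNReal.ofReal_natCast]

theorem frontier_subset_square {N : ℝ} {Z : Set (EuclideanSpace ℝ (Fin 2))}
    (hZ : Z ⊆ {p : EuclideanSpace ℝ (Fin 2) | p 0 ∈ Icc 0 N ∧ p 1 ∈ Icc 0 N}) :
    frontier Z ⊆ {p : EuclideanSpace ℝ (Fin 2) | p 0 ∈ Icc 0 N ∧ p 1 ∈ Icc 0 N} := by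
  refine frontier_subset_closure.trans (closure_minimal hZ ?_)
  have hcont (i : Fin 2) : Continuous fun p : EuclideanSpace ℝ (Fin 2) => p i := by fun_prop
  exact (isClosed_Icc.preimage (hcont 0)).inter (isClosed_Icc.preimage (hcont 1))

/-- Total street length of the uniform skeleton graph: the grid streets
(vertical and horizontal lines `x = j·s`, `y = j·s` for `0 ≤ j ≤ m = ⌊N/s⌋`
inside the square `[0,N]²`) together with the perimeter streets (the boundary
of a well-behaved danger zone `Z`) have one-dimensional Hausdorff measure at
most `2·(m+1)·N + c·N`. -/
theorem uniform_skeleton_street_length (N s c : ℝ)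
    (hN : 0 < N) (hs : 0 < s) (hsN : s ≤ N) (hc : 1 < c)
    (Z : Set (EuclideanSpace ℝ (Fin 2)))
    (hZ : Z ⊆ {p : EuclideanSpace ℝ (Fin 2) |
      p 0 ∈ Icc 0 N ∧ p 1 ∈ Icc 0 N})
    (hwb : ∀ a b x : ℝ, 0 < x →
      μH[1] (frontier Z ∩ {p : EuclideanSpace ℝ (Fin 2) |
          p 0 ∈ Icc a (a + x) ∧ p 1 ∈ Icc b (b + x)}) ≤
        ENNReal.ofReal (c * x)) :
    μH[1]
      (({p : EuclideanSpace ℝ (Fin 2) |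
          (∃ j : ℕ, j ≤ ⌊N / s⌋₊ ∧ p 0 = j * s ∧ p 1 ∈ Icc 0 N) ∨
          (∃ j : ℕ, j ≤ ⌊N / s⌋₊ ∧ p 1 = j * s ∧ p 0 ∈ Icc 0 N)}) ∪
        frontier Z) ≤
      ENNReal.ofReal (2 * (⌊N / s⌋₊ + 1) * N + c * N) := by
  have hper : μH[1] (frontier Z) ≤ ENNReal.ofReal (c * N) := by
    have h := hwb 0 0 N hN
    simp only [zero_add] at h
    rwa [inter_eq_left.2 (frontier_subset_square hZ)] at h
  have hvert := hausdorffMeasure_parallel_segments_le N (fun j => j * s) ⌊N / s⌋₊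
    (zero_ne_one : (0 : Fin 2) ≠ 1)
  have hhor := hausdorffMeasure_parallel_segments_le N (fun j => j * s) ⌊N / s⌋₊
    (one_ne_zero : (1 : Fin 2) ≠ 0)
  have hcN : 0 ≤ c * N := by positivity
  have hmN : (0 : ℝ) ≤ (⌊N / s⌋₊ + 1) * N := by positivity
  rw [show (2 * (⌊N / s⌋₊ + 1) * N + c * N : ℝ) =
      ((⌊N / s⌋₊ + 1) * N + (⌊N / s⌋₊ + 1) * N) + c * N by ring,
    ENNReal.ofReal_add (add_nonneg hmN hmN) hcN, ENNReal.ofReal_add hmN hmN, ofPred_or]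
  exact (measure_union_le _ _).trans
    (add_le_add ((measure_union_le _ _).trans (add_le_add hvert hhor)) hper)
end
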